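/- Let V be a 3-dimensional real vector space and let ρ ∈ Λ(V*) be a non-null spinor (⟨ρ,ρ⟩ ≠ 0). Then the image of the linear map V × V* × ℝ → Λ(V*), u ↦ u·ρ = ι_Xρ + ξ∧ρ + λτρ (for u = (X,ξ,λ)), is exactly the orthogonal complement {ρ}^⊥ = { ψ ∈ Λ(V*) : ⟨ρ,ψ⟩ = 0 }, a 7-dimensional subspace of the 8-dimensional space Λ(V*). -/

import Mathlib

set_option synthInstance.maxHeartbeats 1000000
set_option maxHeartbeats 1000000

open Module ExteriorAlgebra

variable {V : Type*} [AddCommGroup V] [Module ℝ V]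

/-- Projection onto the degree-`k` component of the exterior algebra `Λ(V*)`. -/
noncomputable def gproj (V : Type*) [AddCommGroup V] [Module ℝ V] (k : ℕ) :
    ExteriorAlgebra ℝ (Module.Dual ℝ V) →ₗ[ℝ] ExteriorAlgebra ℝ (Module.Dual ℝ V) :=
  GradedAlgebra.proj (fun i : ℕ => ⋀[ℝ]^i (Module.Dual ℝ V)) k

/-- The Chevalley pairing on `Λ(V*)` for a `3`-dimensional space `V`:
`⟨φ,ψ⟩ = φ₀ψ₃ + ψ₀φ₃ − φ₁∧ψ₂ − ψ₁∧φ₂`. -/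
noncomputable def chevPair (φ ψ : ExteriorAlgebra ℝ (Module.Dual ℝ V)) :
    ExteriorAlgebra ℝ (Module.Dual ℝ V) :=
  gproj V 0 φ * gproj V 3 ψ + gproj V 0 ψ * gproj V 3 φ
    - gproj V 1 φ * gproj V 2 ψ - gproj V 1 ψ * gproj V 2 φ

/-- The Clifford action of a generalized vector `u = (X,ξ,λ) ∈ V × V* × ℝ` on `Λ(V*)`:
`u·φ = ι_Xφ + ξ∧φ + λτφ`. -/
noncomputable def cliffAct (u : V × Module.Dual ℝ V × ℝ)
    (φ : ExteriorAlgebra ℝ (Module.Dual ℝ V)) : ExteriorAlgebra ℝ (Module.Dual ℝ V) :=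
  CliffordAlgebra.contractLeft (Module.Dual.eval ℝ V u.1) φ
    + ExteriorAlgebra.ι ℝ u.2.1 * φ
    + u.2.2 • CliffordAlgebra.involute φ

section Graded

variable {R M : Type*} [CommRing R] [AddCommGroup M] [Module R M]

theorem ι_mul_mem_exteriorPower (a : M) {n : ℕ} {x : ExteriorAlgebra R M} (hx : x ∈ ⋀[R]^n M) :
    ExteriorAlgebra.ι R a * x ∈ ⋀[R]^(n + 1) M := by
  rw [exteriorPower, pow_succ']
  exact Submodule.mul_mem_mul (LinearMap.mem_range_self _ a) hx

theorem mul_mem_exteriorPower {m n : ℕ} {x y : ExteriorAlgebra R M} (hx : x ∈ ⋀[R]^m M)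
    (hy : y ∈ ⋀[R]^n M) : x * y ∈ ⋀[R]^(m + n) M :=
  SetLike.mul_mem_graded (A := fun i : ℕ => ⋀[R]^i M) hx hy

theorem contractLeft_of_mem_exteriorPower_zero (d : Module.Dual R M) {x : ExteriorAlgebra R M}
    (hx : x ∈ ⋀[R]^0 M) : CliffordAlgebra.contractLeft d x = 0 := by
  rw [exteriorPower, pow_zero, Submodule.mem_one] at hx
  obtain ⟨r, rfl⟩ := hx
  exact CliffordAlgebra.contractLeft_algebraMap 0 d r

theorem contractLeft_mem_exteriorPower (d : Module.Dual R M) {n : ℕ} {x : ExteriorAlgebra R M}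
    (hx : x ∈ ⋀[R]^(n + 1) M) : CliffordAlgebra.contractLeft d x ∈ ⋀[R]^n M := by
  suffices h : ∀ (m : ℕ) (x : ExteriorAlgebra R M), x ∈ ⋀[R]^m M → ∀ n, m = n + 1 →
      CliffordAlgebra.contractLeft d x ∈ ⋀[R]^n M from h _ _ hx _ rfl
  intro m x hx
  induction hx using Submodule.pow_induction_on_left' with
  | algebraMap r => intro n h; omega
  | add x y i hx hy ihx ihy =>
    intro n h
    rw [map_add]
    exact add_mem (ihx n h) (ihy n h)
  | mem_mul a ha i x hx ih =>
    intro n h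
    obtain rfl : i = n := by omega
    obtain ⟨a, rfl⟩ := ha
    rw [show ExteriorAlgebra.ι R a = CliffordAlgebra.ι 0 a from rfl,
      CliffordAlgebra.contractLeft_ι_mul]
    refine sub_mem (Submodule.smul_mem _ _ hx) ?_
    cases i with
    | zero =>
      rw [contractLeft_of_mem_exteriorPower_zero d hx, mul_zero]
      exact zero_mem _
    | succ j => exact ι_mul_mem_exteriorPower a (ih j rfl)

theorem involute_of_mem_exteriorPower {n : ℕ} {x : ExteriorAlgebra R M} (hx : x ∈ ⋀[R]^n M) :
    CliffordAlgebra.involute x = (-1 : R) ^ n • x := by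
  induction hx using Submodule.pow_induction_on_left' with
  | algebraMap r => rw [AlgHom.commutes, pow_zero, one_smul]
  | add x y i hx hy ihx ihy => rw [map_add, ihx, ihy, smul_add]
  | mem_mul a ha i x hx ih =>
    obtain ⟨a, rfl⟩ := ha
    rw [map_mul, ih, show ExteriorAlgebra.ι R a = CliffordAlgebra.ι 0 a from rfl,
      CliffordAlgebra.involute_ι, pow_succ]
    simp

theorem mul_ι_of_mem_exteriorPower (a : M) {n : ℕ} {x : ExteriorAlgebra R M}
    (hx : x ∈ ⋀[R]^n M) :
    x * ExteriorAlgebra.ι R a = (-1 : R) ^ n • (ExteriorAlgebra.ι R a * x) := by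
  induction hx using Submodule.pow_induction_on_left' with
  | algebraMap r => rw [pow_zero, one_smul, Algebra.commutes]
  | add x y i hx hy ihx ihy => rw [add_mul, ihx, ihy, mul_add, smul_add]
  | mem_mul b hb i x hx ih =>
    obtain ⟨b, rfl⟩ := hb
    rw [mul_assoc, ih, mul_smul_comm, ← mul_assoc, ← mul_assoc,
      eq_neg_of_add_eq_zero_left (ExteriorAlgebra.ι_add_mul_swap b a), pow_succ]
    simp

theorem contractLeft_mul_of_mem_exteriorPower (d : Module.Dual R M) {n : ℕ}
    {x : ExteriorAlgebra R M} (hx : x ∈ ⋀[R]^n M) (y : ExteriorAlgebra R M) :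
    CliffordAlgebra.contractLeft d (x * y) =
      CliffordAlgebra.contractLeft d x * y +
        (-1 : R) ^ n • (x * CliffordAlgebra.contractLeft d y) := by
  induction hx using Submodule.pow_induction_on_left' with
  | algebraMap r =>
    have h1 := CliffordAlgebra.contractLeft_algebraMap_mul (Q := (0 : QuadraticForm R M)) d r y
    have h2 := CliffordAlgebra.contractLeft_algebraMap (Q := (0 : QuadraticForm R M)) d r
    rw [pow_zero, one_smul]
    exact h1.trans (by rw [h2, zero_mul, zero_add])
  | add x z i hx hz ihx ihz =>
    rw [add_mul, map_add, ihx, ihz, map_add, add_mul, add_mul, smul_add]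
    abel
  | mem_mul a ha i x hx ih =>
    obtain ⟨a, rfl⟩ := ha
    rw [show ExteriorAlgebra.ι R a = CliffordAlgebra.ι 0 a from rfl, mul_assoc,
      CliffordAlgebra.contractLeft_ι_mul, CliffordAlgebra.contractLeft_ι_mul, ih, pow_succ]
    simp only [mul_add, sub_mul, smul_mul_assoc, mul_smul_comm, mul_neg, mul_one, neg_smul,
      mul_assoc]
    abel

theorem contractLeft_involute (d : Module.Dual R M) (x : ExteriorAlgebra R M) :
    CliffordAlgebra.contractLeft d (CliffordAlgebra.involute x) =
      -CliffordAlgebra.involute (CliffordAlgebra.contractLeft d x) := by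
  induction x using CliffordAlgebra.left_induction with
  | algebraMap r => simp
  | add x y hx hy => simp only [map_add, hx, hy, neg_add]
  | ι_mul x a hx =>
    simp only [map_mul, CliffordAlgebra.involute_ι, neg_mul, map_neg,
      CliffordAlgebra.contractLeft_ι_mul, hx, map_sub, map_smul, mul_neg]

theorem exteriorPower_eq_bot_of_finrank_lt {K E : Type*} [Field K] [AddCommGroup E] [Module K E]
    [FiniteDimensional K E] {n : ℕ} (h : Module.finrank K E < n) : ⋀[K]^n E = ⊥ := by
  rw [← Submodule.finrank_eq_zero, exteriorPower.finrank_eq, Nat.choose_eq_zero_of_lt h]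

end Graded

theorem gproj_of_mem {n : ℕ} {x : ExteriorAlgebra ℝ (Module.Dual ℝ V)}
    (hx : x ∈ ⋀[ℝ]^n (Module.Dual ℝ V)) (k : ℕ) : gproj V k x = if n = k then x else 0 := by
  rw [gproj, GradedAlgebra.proj_apply]
  split_ifs with h
  · subst h
    exact DirectSum.decompose_of_mem_same _ hx
  · exact DirectSum.decompose_of_mem_ne _ hx h

theorem gproj_mem (k : ℕ) (x : ExteriorAlgebra ℝ (Module.Dual ℝ V)) :
    gproj V k x ∈ ⋀[ℝ]^k (Module.Dual ℝ V) := by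
  rw [gproj, GradedAlgebra.proj_apply]
  exact SetLike.coe_mem _

theorem gproj_zero_ι_mul (a : Module.Dual ℝ V) (x : ExteriorAlgebra ℝ (Module.Dual ℝ V)) :
    gproj V 0 (ExteriorAlgebra.ι ℝ a * x) = 0 := by
  induction x using DirectSum.Decomposition.inductionOn fun i => ⋀[ℝ]^i (Module.Dual ℝ V) with
  | zero => simp
  | add x y hx hy => rw [mul_add, map_add, hx, hy, add_zero]
  | homogeneous x => rw [gproj_of_mem (ι_mul_mem_exteriorPower a x.2), if_neg (by omega)]

theorem gproj_succ_ι_mul (k : ℕ) (a : Module.Dual ℝ V)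
    (x : ExteriorAlgebra ℝ (Module.Dual ℝ V)) :
    gproj V (k + 1) (ExteriorAlgebra.ι ℝ a * x) = ExteriorAlgebra.ι ℝ a * gproj V k x := by
  induction x using DirectSum.Decomposition.inductionOn fun i => ⋀[ℝ]^i (Module.Dual ℝ V) with
  | zero => simp
  | add x y hx hy => rw [mul_add, map_add, hx, hy, map_add, mul_add]
  | homogeneous x =>
    rw [gproj_of_mem (ι_mul_mem_exteriorPower a x.2), gproj_of_mem x.2]
    simp only [Nat.add_right_cancel_iff, mul_ite, mul_zero]

theorem gproj_contractLeft (k : ℕ) (d : Module.Dual ℝ (Module.Dual ℝ V))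
    (x : ExteriorAlgebra ℝ (Module.Dual ℝ V)) :
    gproj V k (CliffordAlgebra.contractLeft d x) =
      CliffordAlgebra.contractLeft d (gproj V (k + 1) x) := by
  induction x using DirectSum.Decomposition.inductionOn fun i => ⋀[ℝ]^i (Module.Dual ℝ V) with
  | zero => simp
  | add x y hx hy => simp only [map_add, hx, hy]
  | @homogeneous i x =>
    cases i with
    | zero =>
      rw [contractLeft_of_mem_exteriorPower_zero d x.2, gproj_of_mem x.2, if_neg (by omega),
        map_zero, map_zero]
    | succ i =>
      rw [gproj_of_mem (contractLeft_mem_exteriorPower d x.2), gproj_of_mem x.2]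
      simp only [Nat.add_right_cancel_iff]
      split_ifs <;> simp

theorem gproj_involute (k : ℕ) (x : ExteriorAlgebra ℝ (Module.Dual ℝ V)) :
    gproj V k (CliffordAlgebra.involute x) = (-1 : ℝ) ^ k • gproj V k x := by
  induction x using DirectSum.Decomposition.inductionOn fun i => ⋀[ℝ]^i (Module.Dual ℝ V) with
  | zero => simp
  | add x y hx hy => simp only [map_add, hx, hy, smul_add]
  | homogeneous x =>
    rw [involute_of_mem_exteriorPower x.2, map_smul, gproj_of_mem x.2]
    split_ifs with h
    · subst h
      rfl
    · simp

theorem chevPair_comm (φ ψ : ExteriorAlgebra ℝ (Module.Dual ℝ V)) :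
    chevPair φ ψ = chevPair ψ φ := by
  simp only [chevPair]
  abel

/-- The Chevalley pairing against a fixed spinor, as a linear map. -/
noncomputable def chevPairLeft (φ : ExteriorAlgebra ℝ (Module.Dual ℝ V)) :
    ExteriorAlgebra ℝ (Module.Dual ℝ V) →ₗ[ℝ] ExteriorAlgebra ℝ (Module.Dual ℝ V) where
  toFun := chevPair φ
  map_add' x y := by
    simp only [chevPair, map_add, mul_add, add_mul]
    abel
  map_smul' c x := by
    simp only [chevPair, map_smul, mul_smul_comm, smul_mul_assoc, smul_add, smul_sub,
      RingHom.id_apply]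

theorem chevPair_add_right (φ x y : ExteriorAlgebra ℝ (Module.Dual ℝ V)) :
    chevPair φ (x + y) = chevPair φ x + chevPair φ y :=
  map_add (chevPairLeft φ) x y

theorem chevPair_smul_right (c : ℝ) (φ x : ExteriorAlgebra ℝ (Module.Dual ℝ V)) :
    chevPair φ (c • x) = c • chevPair φ x :=
  map_smul (chevPairLeft φ) c x

theorem chevPair_zero_right (φ : ExteriorAlgebra ℝ (Module.Dual ℝ V)) : chevPair φ 0 = 0 :=
  map_zero (chevPairLeft φ)

theorem chevPair_add_left (x y φ : ExteriorAlgebra ℝ (Module.Dual ℝ V)) :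
    chevPair (x + y) φ = chevPair x φ + chevPair y φ := by
  simp only [chevPair_comm _ φ, chevPair_add_right]

theorem chevPair_mem (φ ψ : ExteriorAlgebra ℝ (Module.Dual ℝ V)) :
    chevPair φ ψ ∈ ⋀[ℝ]^3 (Module.Dual ℝ V) :=
  sub_mem (sub_mem (add_mem
    (mul_mem_exteriorPower (gproj_mem 0 φ) (gproj_mem 3 ψ))
    (mul_mem_exteriorPower (gproj_mem 0 ψ) (gproj_mem 3 φ)))
    (mul_mem_exteriorPower (gproj_mem 1 φ) (gproj_mem 2 ψ)))
    (mul_mem_exteriorPower (gproj_mem 1 ψ) (gproj_mem 2 φ))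

/-- The Clifford action on a fixed spinor, as a linear map in the generalized vector. -/
noncomputable def cliffActOn (φ : ExteriorAlgebra ℝ (Module.Dual ℝ V)) :
    (V × Module.Dual ℝ V × ℝ) →ₗ[ℝ] ExteriorAlgebra ℝ (Module.Dual ℝ V) where
  toFun u := cliffAct u φ
  map_add' u v := by
    simp only [cliffAct, Prod.fst_add, Prod.snd_add, map_add, LinearMap.add_apply, add_mul,
      add_smul]
    abel
  map_smul' c u := by
    simp only [cliffAct, Prod.smul_fst, Prod.smul_snd, map_smul, LinearMap.smul_apply,
      smul_mul_assoc, smul_add, smul_assoc, RingHom.id_apply]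

theorem cliffAct_add_right (u : V × Module.Dual ℝ V × ℝ)
    (x y : ExteriorAlgebra ℝ (Module.Dual ℝ V)) :
    cliffAct u (x + y) = cliffAct u x + cliffAct u y := by
  simp only [cliffAct, map_add, mul_add, smul_add]
  abel

/-- The Clifford relation for the Clifford action. -/
theorem cliffAct_cliffAct_add_swap (u v : V × Module.Dual ℝ V × ℝ)
    (φ : ExteriorAlgebra ℝ (Module.Dual ℝ V)) :
    cliffAct u (cliffAct v φ) + cliffAct v (cliffAct u φ) =
      (v.2.1 u.1 + u.2.1 v.1 + 2 * (u.2.2 * v.2.2)) • φ := by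
  obtain ⟨X, ξ, s⟩ := u
  obtain ⟨Y, η, t⟩ := v
  have hι : ExteriorAlgebra.ι ℝ ξ * (ExteriorAlgebra.ι ℝ η * φ) =
      -(ExteriorAlgebra.ι ℝ η * (ExteriorAlgebra.ι ℝ ξ * φ)) := by
    rw [← mul_assoc, ← mul_assoc,
      eq_neg_of_add_eq_zero_left (ExteriorAlgebra.ι_add_mul_swap ξ η), neg_mul]
  have hd := CliffordAlgebra.contractLeft_comm (Q := (0 : QuadraticForm ℝ (Module.Dual ℝ V)))
    (d := Module.Dual.eval ℝ V X) (d' := Module.Dual.eval ℝ V Y) φ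
  have hdι (Z : V) (ζ : Module.Dual ℝ V) :
      CliffordAlgebra.contractLeft (Module.Dual.eval ℝ V Z) (ExteriorAlgebra.ι ℝ ζ * φ) =
        ζ Z • φ -
          ExteriorAlgebra.ι ℝ ζ * CliffordAlgebra.contractLeft (Module.Dual.eval ℝ V Z) φ :=
    CliffordAlgebra.contractLeft_ι_mul _ ζ φ
  have hτι (ζ : Module.Dual ℝ V) :
      CliffordAlgebra.involute (ExteriorAlgebra.ι ℝ ζ * φ) =
        -(ExteriorAlgebra.ι ℝ ζ * CliffordAlgebra.involute φ) := by
    rw [map_mul, show ExteriorAlgebra.ι ℝ ζ = CliffordAlgebra.ι 0 ζ from rfl,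
      CliffordAlgebra.involute_ι, neg_mul]
  simp only [cliffAct, map_add, mul_add, map_smul, contractLeft_involute, hdι, hτι, hd, hι,
    CliffordAlgebra.involute_involute, mul_smul_comm]
  module

theorem chevPair_cliffAct_self [FiniteDimensional ℝ V] (h3 : Module.finrank ℝ V = 3)
    (u : V × Module.Dual ℝ V × ℝ) (φ : ExteriorAlgebra ℝ (Module.Dual ℝ V)) :
    chevPair φ (cliffAct u φ) = 0 := by
  obtain ⟨X, ξ, s⟩ := u
  have hbot {x : ExteriorAlgebra ℝ (Module.Dual ℝ V)} (hx : x ∈ ⋀[ℝ]^4 (Module.Dual ℝ V)) :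
      x = 0 := by
    rwa [exteriorPower_eq_bot_of_finrank_lt (by rw [Subspace.dual_finrank_eq, h3]; norm_num),
      Submodule.mem_bot] at hx
  obtain ⟨a, ha⟩ : ∃ a, ExteriorAlgebra.ι ℝ a = gproj V 1 φ := by
    simpa [exteriorPower] using gproj_mem 1 φ
  obtain ⟨r, hr⟩ : ∃ r, algebraMap ℝ _ r = gproj V 0 φ := by
    simpa [exteriorPower, Submodule.mem_one] using gproj_mem 0 φ
  simp only [cliffAct]
  generalize Module.Dual.eval ℝ V X = d
  have h13 : CliffordAlgebra.contractLeft d (gproj V 1 φ) * gproj V 3 φ =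
      gproj V 1 φ * CliffordAlgebra.contractLeft d (gproj V 3 φ) := by
    have h := contractLeft_mul_of_mem_exteriorPower d (gproj_mem 1 φ) (gproj V 3 φ)
    rw [hbot (mul_mem_exteriorPower (gproj_mem 1 φ) (gproj_mem 3 φ)), map_zero] at h
    rw [← sub_eq_zero, h]
    module
  have h22 : CliffordAlgebra.contractLeft d (gproj V 2 φ) * gproj V 2 φ = 0 := by
    have h := contractLeft_mul_of_mem_exteriorPower d (gproj_mem 2 φ) (gproj V 2 φ)
    obtain ⟨b, hb⟩ : ∃ b, ExteriorAlgebra.ι ℝ b =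
        CliffordAlgebra.contractLeft d (gproj V 2 φ) := by
      simpa [exteriorPower] using contractLeft_mem_exteriorPower d (gproj_mem 2 φ)
    rw [hbot (mul_mem_exteriorPower (gproj_mem 2 φ) (gproj_mem 2 φ)), map_zero, ← hb,
      mul_ι_of_mem_exteriorPower b (gproj_mem 2 φ)] at h
    rw [← hb]
    have h2 : (2 : ℝ) • (ExteriorAlgebra.ι ℝ b * gproj V 2 φ) = 0 := by
      rw [h]
      module
    exact (smul_eq_zero.mp h2).resolve_left two_ne_zero
  have h11 : gproj V 1 φ * (ExteriorAlgebra.ι ℝ ξ * gproj V 1 φ) = 0 := by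
    rw [← ha, ← mul_assoc, eq_neg_of_add_eq_zero_left (ExteriorAlgebra.ι_add_mul_swap a ξ),
      neg_mul, mul_assoc, ExteriorAlgebra.ι_sq_zero, mul_zero, neg_zero]
  simp only [chevPair, map_add, map_smul, gproj_contractLeft, gproj_involute, gproj_zero_ι_mul,
    Nat.reduceAdd, hbot (gproj_mem 4 φ), map_zero, smul_zero, zero_mul, mul_add, add_mul,
    mul_smul_comm, smul_mul_assoc, h11, h13, h22,
    gproj_succ_ι_mul 0, gproj_succ_ι_mul 1, gproj_succ_ι_mul 2, ← hr,
    ← Algebra.smul_def, ← Algebra.commutes r]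
  module

theorem chevPair_cliffAct_swap [FiniteDimensional ℝ V] (h3 : Module.finrank ℝ V = 3)
    (u : V × Module.Dual ℝ V × ℝ) (φ ψ : ExteriorAlgebra ℝ (Module.Dual ℝ V)) :
    chevPair φ (cliffAct u ψ) = -chevPair ψ (cliffAct u φ) := by
  have h := chevPair_cliffAct_self h3 u (φ + ψ)
  rw [cliffAct_add_right, chevPair_add_left, chevPair_add_right, chevPair_add_right,
    chevPair_cliffAct_self h3, chevPair_cliffAct_self h3, zero_add, add_zero] at h
  exact eq_neg_of_add_eq_zero_left h

theorem cliffActOn_injective [FiniteDimensional ℝ V] (h3 : Module.finrank ℝ V = 3)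
    {ρ : ExteriorAlgebra ℝ (Module.Dual ℝ V)} (hρ : chevPair ρ ρ ≠ 0) :
    Function.Injective (cliffActOn ρ) := by
  rw [injective_iff_map_eq_zero]
  intro u (hu : cliffAct u ρ = 0)
  have hpair (v : V × Module.Dual ℝ V × ℝ) :
      v.2.1 u.1 + u.2.1 v.1 + 2 * (u.2.2 * v.2.2) = 0 := by
    have h := congrArg (chevPair ρ) (cliffAct_cliffAct_add_swap u v ρ)
    rw [chevPair_add_right, chevPair_cliffAct_swap h3 u, hu, chevPair_zero_right,
      chevPair_cliffAct_swap h3 v, chevPair_comm 0, chevPair_zero_right, chevPair_smul_right] at h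
    simpa [hρ] using h.symm
  obtain ⟨X, ξ, s⟩ := u
  have hX : X = 0 := (Module.forall_dual_apply_eq_zero_iff ℝ X).mp fun η => by
    simpa using hpair (0, η, 0)
  have hξ : ξ = 0 := LinearMap.ext fun Y => by simpa using hpair (Y, 0, 0)
  have hs : s = 0 := by simpa using hpair (0, 0, 1)
  rw [hX, hξ, hs]
  rfl

theorem finrank_exteriorAlgebra_dual [FiniteDimensional ℝ V] :
    Module.finrank ℝ (ExteriorAlgebra ℝ (Module.Dual ℝ V)) = 2 ^ Module.finrank ℝ V := by
  rw [Module.finrank_eq_card_basis (Module.finBasis ℝ (Module.Dual ℝ V)).ExteriorAlgebra,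
    Fintype.card_finset, Fintype.card_fin, Subspace.dual_finrank_eq]

theorem finrank_ker_chevPairLeft [FiniteDimensional ℝ V] (h3 : Module.finrank ℝ V = 3)
    {ρ : ExteriorAlgebra ℝ (Module.Dual ℝ V)} (hρ : chevPair ρ ρ ≠ 0) :
    Module.finrank ℝ (LinearMap.ker (chevPairLeft ρ)) = 7 := by
  have h8 : Module.finrank ℝ (ExteriorAlgebra ℝ (Module.Dual ℝ V)) = 8 := by
    rw [finrank_exteriorAlgebra_dual, h3]
    norm_num
  have : FiniteDimensional ℝ (ExteriorAlgebra ℝ (Module.Dual ℝ V)) :=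
    Module.finite_of_finrank_eq_succ h8
  have hle : LinearMap.range (chevPairLeft ρ) ≤ ⋀[ℝ]^3 (Module.Dual ℝ V) := by
    rintro _ ⟨ψ, rfl⟩
    exact chevPair_mem ρ ψ
  have hrange := Submodule.finrank_mono hle
  rw [exteriorPower.finrank_eq, Subspace.dual_finrank_eq, h3, Nat.choose_self] at hrange
  have hpos : Module.finrank ℝ (LinearMap.range (chevPairLeft ρ)) ≠ 0 := fun h =>
    hρ ((Submodule.mem_bot ℝ).mp
      (Submodule.finrank_eq_zero.mp h ▸ LinearMap.mem_range_self (chevPairLeft ρ) ρ))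
  have hsum := LinearMap.finrank_range_add_finrank_ker (chevPairLeft ρ)
  omega

/-- On a `3`-dimensional space, for a non-null spinor `ρ` the image of the map
`u ↦ u·ρ`, `u ∈ V × V* × ℝ`, is exactly the orthogonal complement
`{ρ}^⊥ = {ψ | ⟨ρ,ψ⟩ = 0}`, a `7`-dimensional subspace of the `8`-dimensional
space `Λ(V*)`. -/
theorem cliffAct_range_eq_perp [FiniteDimensional ℝ V]
    (h3 : Module.finrank ℝ V = 3)
    (ρ : ExteriorAlgebra ℝ (Module.Dual ℝ V)) (hρ : chevPair ρ ρ ≠ 0) :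
    Set.range (fun u : V × Module.Dual ℝ V × ℝ => cliffAct u ρ)
        = {ψ : ExteriorAlgebra ℝ (Module.Dual ℝ V) | chevPair ρ ψ = 0} ∧
    (∃ p : Submodule ℝ (ExteriorAlgebra ℝ (Module.Dual ℝ V)),
        (p : Set (ExteriorAlgebra ℝ (Module.Dual ℝ V)))
            = {ψ : ExteriorAlgebra ℝ (Module.Dual ℝ V) | chevPair ρ ψ = 0} ∧
        Module.finrank ℝ p = 7) ∧
    Module.finrank ℝ (ExteriorAlgebra ℝ (Module.Dual ℝ V)) = 8 := by
  have hker := finrank_ker_chevPairLeft h3 hρ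
  have h8 : Module.finrank ℝ (ExteriorAlgebra ℝ (Module.Dual ℝ V)) = 8 := by
    rw [finrank_exteriorAlgebra_dual, h3]
    norm_num
  have : FiniteDimensional ℝ (ExteriorAlgebra ℝ (Module.Dual ℝ V)) :=
    Module.finite_of_finrank_eq_succ h8
  have heq : LinearMap.range (cliffActOn ρ) = LinearMap.ker (chevPairLeft ρ) := by
    refine Submodule.eq_of_le_of_finrank_eq ?_ ?_
    · rintro _ ⟨u, rfl⟩
      exact chevPair_cliffAct_self h3 u ρ
    · rw [LinearMap.finrank_range_of_inj (cliffActOn_injective h3 hρ), hker,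
        Module.finrank_prod, Module.finrank_prod, Subspace.dual_finrank_eq, h3,
        Module.finrank_self]
  exact ⟨congrArg SetLike.coe heq, ⟨LinearMap.ker (chevPairLeft ρ), rfl, hker⟩, h8⟩
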